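/- (Total contribution of positive selection is less than one half.) In the multi-locus Wright–Fisher graph setup with integer N satisfying N ≥ 2 and N ≥ 4C² where C = max_{j,u,v} |γ^j_{uv}|, and assuming the total weight T = ∑_{j=1}^L ∑_{u,v∈V} (η^j_u/Ω^j_N) θ_{uv} is strictly positive, one has ∑_{j=1}^L ∑_{u,v∈V} (η^j_u/Ω^j_N) θ_{uv} · 1{γ^j_{uv} > 0} < T/2. -/

import Mathlib

/-- Scaled fixation factor: `ω_γ = 2γ/(1 − e^{−2γ})` for `γ ≠ 0`, and `ω_0 = 1`. -/
noncomputable def omegaSel (γ : ℝ) : ℝ :=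
  if γ = 0 then 1 else 2 * γ / (1 - Real.exp (-2 * γ))

/-- `K_γ = ω_γ ∫_0^1 (−ln y)(e^{−2γy} − e^{−2γ(1−y)}) dy`. -/
noncomputable def Ksel (γ : ℝ) : ℝ :=
  omegaSel γ *
    ∫ y in (0:ℝ)..1, (-Real.log y) * (Real.exp (-2 * γ * y) - Real.exp (-2 * γ * (1 - y)))

noncomputable def JJ (a : ℝ) : ℝ :=
  ∫ y in (0:ℝ)..1, (-Real.log y) * (Real.exp (-a * y) - Real.exp (-a * (1 - y)))

lemma JJ_int (f : ℝ → ℝ) (hf : Continuous f) (p q : ℝ) :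
    IntervalIntegrable (fun y => (-Real.log y) * f y) MeasureTheory.volume p q :=
  (intervalIntegral.intervalIntegrable_log'.neg).mul_continuousOn hf.continuousOn

lemma JJ_nonneg (a : ℝ) (ha : 0 < a) : 0 ≤ JJ a := by
  have h0 : ∫ y in (0:ℝ)..1, Real.log 2 * (Real.exp (-a * y) - Real.exp (-a * (1 - y))) = 0 := by
    rw [intervalIntegral.integral_const_mul, intervalIntegral.integral_sub]
    · have := intervalIntegral.integral_comp_sub_left (a := 0) (b := 1)
        (fun y => Real.exp (-a * y)) 1
      simp only [sub_self, sub_zero] at this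
      rw [this]; simp
    · exact Continuous.intervalIntegrable (by fun_prop) _ _
    · exact Continuous.intervalIntegrable (by fun_prop) _ _
  rw [← h0]
  unfold JJ
  apply intervalIntegral.integral_mono_on_of_le_Ioo (by norm_num)
  · exact Continuous.intervalIntegrable (by fun_prop) _ _
  · exact JJ_int _ (by fun_prop) _ _
  · intro y hy
    have hl : Real.log (2⁻¹) = - Real.log 2 := Real.log_inv 2
    rcases le_total y (2⁻¹) with h | h
    · have h1 : Real.log y ≤ - Real.log 2 := hl ▸ Real.log_le_log hy.1 h
      have h2 : Real.exp (-a * (1 - y)) ≤ Real.exp (-a * y) :=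
        Real.exp_le_exp.2 (by nlinarith)
      apply mul_le_mul_of_nonneg_right <;> linarith
    · have h1 : - Real.log 2 ≤ Real.log y := hl ▸ Real.log_le_log (by norm_num) h
      have h2 : Real.exp (-a * y) ≤ Real.exp (-a * (1 - y)) :=
        Real.exp_le_exp.2 (by nlinarith)
      apply mul_le_mul_of_nonpos_right <;> linarith

lemma JJ_le1 (a : ℝ) (ha : 0 < a) : JJ a ≤ 1 - Real.exp (-a) := by
  have h0 : ∫ y in (0:ℝ)..1, (-Real.log y) * (1 - Real.exp (-a)) = 1 - Real.exp (-a) := by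
    rw [intervalIntegral.integral_mul_const, intervalIntegral.integral_neg, integral_log]
    simp
  rw [← h0]
  unfold JJ
  apply intervalIntegral.integral_mono_on_of_le_Ioo (by norm_num)
  · exact JJ_int _ (by fun_prop) _ _
  · exact JJ_int _ (by fun_prop) _ _
  · intro y hy
    have h1 : Real.log y ≤ 0 := Real.log_nonpos hy.1.le hy.2.le
    have h2 : Real.exp (-a * y) ≤ 1 := Real.exp_le_one_iff.2 (by nlinarith [hy.1])
    have h3 : Real.exp (-a) ≤ Real.exp (-a * (1 - y)) :=
        Real.exp_le_exp.2 (by nlinarith [hy.1])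
    apply mul_le_mul_of_nonneg_left <;> linarith

lemma JJ_le2 (a : ℝ) (ha : 2 ≤ a) :
    a * JJ a ≤ 1 + Real.log a * (1 + Real.exp (-1) - Real.exp (-a)) := by
  have ha0 : 0 < a := by linarith
  have hi0 : 0 < a⁻¹ := inv_pos.2 ha0
  have hi1 : a⁻¹ ≤ 1 := inv_le_one_of_one_le₀ (by linarith)
  have hla : 0 ≤ Real.log a := Real.log_nonneg (by linarith)
  have hs : JJ a = (∫ y in (0:ℝ)..a⁻¹, (-Real.log y) * (Real.exp (-a * y) - Real.exp (-a * (1 - y))))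
      + ∫ y in a⁻¹..1, (-Real.log y) * (Real.exp (-a * y) - Real.exp (-a * (1 - y))) :=
    (intervalIntegral.integral_add_adjacent_intervals (JJ_int _ (by fun_prop) _ _)
      (JJ_int _ (by fun_prop) _ _)).symm
  have b1 : (∫ y in (0:ℝ)..a⁻¹, (-Real.log y) * (Real.exp (-a * y) - Real.exp (-a * (1 - y))))
      ≤ a⁻¹ * (1 + Real.log a) := by
    have h0 : ∫ y in (0:ℝ)..a⁻¹, (-Real.log y) * 1 = a⁻¹ * (1 + Real.log a) := by
      rw [intervalIntegral.integral_mul_const, intervalIntegral.integral_neg, integral_log]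
      simp; ring
    rw [← h0]
    apply intervalIntegral.integral_mono_on_of_le_Ioo hi0.le
    · exact JJ_int _ (by fun_prop) _ _
    · exact JJ_int _ (by fun_prop) _ _
    · intro y hy
      have h1 : Real.log y ≤ 0 := Real.log_nonpos hy.1.le (hy.2.le.trans hi1)
      have h2 : Real.exp (-a * y) ≤ 1 := Real.exp_le_one_iff.2 (by nlinarith [hy.1])
      have h3 := Real.exp_pos (-a * (1 - y))
      apply mul_le_mul_of_nonneg_left <;> linarith
  have b2 : (∫ y in a⁻¹..1, (-Real.log y) * (Real.exp (-a * y) - Real.exp (-a * (1 - y))))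
      ≤ Real.log a * (a⁻¹ * (Real.exp (-1) - Real.exp (-a))) := by
    have h0 : ∫ y in a⁻¹..1, Real.log a * Real.exp (-a * y)
        = Real.log a * (a⁻¹ * (Real.exp (-1) - Real.exp (-a))) := by
      rw [intervalIntegral.integral_const_mul]
      congr 1
      rw [intervalIntegral.integral_comp_mul_left (fun y => Real.exp y) (by linarith : -a ≠ 0), integral_exp]
      have : -a * a⁻¹ = -1 := by field_simp
      rw [this]; simp only [smul_eq_mul, mul_one, inv_neg]; ring
    rw [← h0]
    apply intervalIntegral.integral_mono_on_of_le_Ioo hi1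
    · exact JJ_int _ (by fun_prop) _ _
    · exact Continuous.intervalIntegrable (by fun_prop) _ _
    · intro y hy
      have hy0 : 0 < y := hi0.trans hy.1
      have h1 : Real.log y ≤ 0 := Real.log_nonpos hy0.le hy.2.le
      have h1' : -Real.log a ≤ Real.log y := by
        rw [← Real.log_inv]; exact Real.log_le_log hi0 hy.1.le
      have h2 := Real.exp_pos (-a * y)
      have h3 := Real.exp_pos (-a * (1 - y))
      nlinarith
  have hb : JJ a ≤ a⁻¹ * (1 + Real.log a * (1 + Real.exp (-1) - Real.exp (-a))) := by
    rw [hs]; linarith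
  calc a * JJ a ≤ a * (a⁻¹ * (1 + Real.log a * (1 + Real.exp (-1) - Real.exp (-a)))) :=
        mul_le_mul_of_nonneg_left hb ha0.le
    _ = _ := by field_simp

lemma JJ_bound (a : ℝ) (ha : 0 < a) (N : ℕ) (hN : 2 ≤ N) (h : a ^ 2 ≤ N) :
    a / (1 - Real.exp (-a)) * JJ a ≤ 1 + Real.log N := by
  have hE : 0 < 1 - Real.exp (-a) := by
    have : Real.exp (-a) < 1 := Real.exp_lt_one_iff.2 (by linarith)
    linarith
  have hl2 := Real.log_two_gt_d9
  rcases le_total a 2 with h2 | h2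
  · have : a / (1 - Real.exp (-a)) * JJ a ≤ a := by
      calc _ ≤ a / (1 - Real.exp (-a)) * (1 - Real.exp (-a)) :=
            mul_le_mul_of_nonneg_left (JJ_le1 a ha) (by positivity)
        _ = a := by field_simp
    refine this.trans ?_
    rcases le_total a 1.69 with h3 | h3
    · have : Real.log 2 ≤ Real.log N := Real.log_le_log (by norm_num) (by exact_mod_cast hN)
      linarith
    · have h4 : (2:ℝ) < N := by nlinarith
      have h5 : 3 ≤ N := by exact_mod_cast h4
      have h6 : Real.log 3 ≤ Real.log N := Real.log_le_log (by norm_num) (by exact_mod_cast h5)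
      have h7 : 1 ≤ Real.log 3 := by
        rw [Real.le_log_iff_exp_le (by norm_num)]
        linarith [Real.exp_one_lt_d9]
      linarith
  · have hb := JJ_le2 a h2
    have h1 : 2 * Real.log a ≤ Real.log N := by
      have := Real.log_le_log (by positivity) h
      rwa [Real.log_pow] at this
    have h3 : Real.log 2 ≤ Real.log a := Real.log_le_log (by norm_num) h2
    have e1 : Real.exp (-1) < 0.3679 := by linarith [Real.exp_neg_one_lt_d9]
    have e1p := Real.exp_pos (-1)
    have e2 : Real.exp (-a) ≤ 0.14 := by
      have : Real.exp (-a) ≤ Real.exp (-1 + -1) := Real.exp_le_exp.2 (by linarith)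
      rw [Real.exp_add] at this
      nlinarith
    have e2p := Real.exp_pos (-a)
    have : a / (1 - Real.exp (-a)) * JJ a ≤ 1 + 2 * Real.log a := by
      rw [div_mul_eq_mul_div, div_le_iff₀ hE]
      nlinarith
    linarith

lemma omega_pos (g : ℝ) : 0 < omegaSel g := by
  unfold omegaSel
  split_ifs with h
  · norm_num
  · rcases lt_or_gt_of_ne h with h | h
    · have : 1 < Real.exp (-2 * g) := Real.one_lt_exp_iff.2 (by linarith)
      exact div_pos_of_neg_of_neg (by linarith) (by linarith)
    · have : Real.exp (-2 * g) < 1 := Real.exp_lt_one_iff.2 (by linarith)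
      exact div_pos (by linarith) (by linarith)

lemma omega_neg (g : ℝ) : omegaSel (-g) = Real.exp (-(2 * g)) * omegaSel g := by
  unfold omegaSel
  by_cases h : g = 0
  · simp [h]
  · have hne : Real.exp (-(2 * g)) ≠ 1 := by
      rw [Ne, Real.exp_eq_one_iff]; intro h'; apply h; linarith
    have hp := Real.exp_pos (-(2 * g))
    have hx : Real.exp (-2 * -g) = (Real.exp (-(2 * g)))⁻¹ := by
      rw [← Real.exp_neg]; congr 1; ring
    rw [if_neg (by simpa using h), if_neg h, hx, show -2 * g = -(2 * g) by ring]
    generalize Real.exp (-(2 * g)) = E at *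
    have h1 : 1 - E ≠ 0 := sub_ne_zero.2 hne.symm
    have h2 : 1 - E⁻¹ ≠ 0 := by
      intro h3; apply hne
      have : E⁻¹ = 1 := by linarith
      simpa using this
    have h3 : E - 1 ≠ 0 := sub_ne_zero.2 hne
    rw [div_eq_iff h2]
    field_simp
    ring

lemma K_eq (g : ℝ) : Ksel g = omegaSel g * JJ (2 * g) := by
  unfold Ksel JJ
  simp only [neg_mul]

lemma JJ_neg (a : ℝ) : JJ (-a) = - (Real.exp a * JJ a) := by
  unfold JJ
  rw [← intervalIntegral.integral_const_mul, ← intervalIntegral.integral_neg]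
  congr 1
  funext y
  have h1 : Real.exp (- -a * y) = Real.exp a * Real.exp (-a * (1 - y)) := by
    rw [← Real.exp_add]; congr 1; ring
  have h2 : Real.exp (- -a * (1 - y)) = Real.exp a * Real.exp (-a * y) := by
    rw [← Real.exp_add]; congr 1; ring
  rw [h1, h2]; ring

lemma K_neg (g : ℝ) : Ksel (-g) = - Ksel g := by
  rw [K_eq, K_eq, omega_neg, mul_neg, JJ_neg, Real.exp_neg]
  have := Real.exp_pos (2 * g)
  field_simp

lemma K_bound (g : ℝ) (N : ℕ) (hN : 2 ≤ N) (h : 4 * g ^ 2 ≤ N) :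
    0 ≤ 1 + Real.log N + Ksel g := by
  have hlog : 0 ≤ Real.log N := Real.log_nonneg (by exact_mod_cast (by omega : 1 ≤ N))
  rcases lt_trichotomy g 0 with hg | hg | hg
  · have h1 := JJ_bound (2 * -g) (by linarith) N hN (by nlinarith)
    have h2 : Ksel (-g) ≤ 1 + Real.log N := by
      rw [K_eq]
      unfold omegaSel
      rw [if_neg (by linarith)]
      convert h1 using 5
      ring
    rw [K_neg] at h2
    linarith
  · have : Ksel g = 0 := by
      have := K_neg 0
      rw [neg_zero] at this
      rw [hg]; linarith
    linarith
  · have : 0 ≤ Ksel g := by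
      rw [K_eq]; exact mul_nonneg (omega_pos g).le (JJ_nonneg _ (by linarith))
    linarith

lemma pair_bound (g a b : ℝ) (ha : 0 ≤ a) (hb : 0 ≤ b)
    (h : a * omegaSel g = b * omegaSel (-g)) :
    a * (if 0 < g then (1:ℝ) else 0) + b * (if 0 < -g then (1:ℝ) else 0) ≤ (a + b) / 2 ∧
    (0 < a → a * (if 0 < g then (1:ℝ) else 0) + b * (if 0 < -g then (1:ℝ) else 0) < (a + b) / 2) := by
  have hw := omega_pos g
  have h' : a = b * Real.exp (-(2 * g)) := by
    rw [omega_neg] at h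
    apply mul_right_cancel₀ hw.ne'
    linarith
  rcases lt_trichotomy g 0 with hg | hg | hg
  · rw [if_neg (by linarith), if_pos (by linarith)]
    have : 1 < Real.exp (-(2 * g)) := Real.one_lt_exp_iff.2 (by linarith)
    refine ⟨by nlinarith, fun h0 => ?_⟩
    have : 0 < b := by
      rcases hb.eq_or_lt with hb | hb
      · rw [← hb] at h'; linarith
      · exact hb
    nlinarith
  · subst hg
    simp only [neg_zero, lt_irrefl, if_false]
    exact ⟨by linarith, fun _ => by linarith⟩
  · rw [if_pos hg, if_neg (by linarith)]
    have : Real.exp (-(2 * g)) < 1 := Real.exp_lt_one_iff.2 (by linarith)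
    refine ⟨by nlinarith, fun h0 => ?_⟩
    have : 0 < b := by
      rcases hb.eq_or_lt with hb | hb
      · rw [← hb] at h'; linarith
      · exact hb
    nlinarith

/-- The total weight of strictly positive selection coefficients in the DFE of novel
mutations is less than half of the total weight. -/
theorem dfe_positive_mass_lt_half {V : Type*} [Fintype V]
    (L N : ℕ) (hL : 1 ≤ L) (hN : 2 ≤ N)
    (θ : V → V → ℝ) (hθ : ∀ u v, 0 ≤ θ u v) (hθdiag : ∀ u, θ u u = 0)
    (γ : Fin L → V → V → ℝ) (hγ : ∀ j u v, γ j u v = -γ j v u)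
    (η : Fin L → V → ℝ) (hη0 : ∀ j u, 0 ≤ η j u) (hη1 : ∀ j, ∑ u, η j u = 1)
    (hdb : ∀ j u v,
      η j u * θ u v * omegaSel (γ j u v) = η j v * θ v u * omegaSel (γ j v u))
    (C : ℝ) (hC : ∀ j u v, |γ j u v| ≤ C) (hNC : 4 * C ^ 2 ≤ (N : ℝ))
    (Ω : Fin L → ℝ)
    (hΩ : ∀ j, Ω j = 1 + (2 / L) *
      ∑ u, ∑ v, η j u * θ u v * (1 + Real.log N + Ksel (γ j u v)))
    (T : ℝ) (hT : T = ∑ j, ∑ u, ∑ v, (η j u / Ω j) * θ u v) (hTpos : 0 < T) :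
    (∑ j, ∑ u, ∑ v, (η j u / Ω j) * θ u v * (if 0 < γ j u v then (1:ℝ) else 0)) < T / 2 := by
  have hΩ0 : ∀ j, 0 ≤ Ω j := by
    intro j
    rw [hΩ j]
    have : 0 ≤ ∑ u, ∑ v, η j u * θ u v * (1 + Real.log N + Ksel (γ j u v)) := by
      refine Finset.sum_nonneg fun u _ => Finset.sum_nonneg fun v _ => ?_
      refine mul_nonneg (mul_nonneg (hη0 j u) (hθ u v)) (K_bound _ N hN ?_)
      have h1 := hC j u v
      have h2 := abs_nonneg (γ j u v)
      have h3 := sq_abs (γ j u v)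
      nlinarith
    positivity
  set w : Fin L → V → V → ℝ := fun j u v => (η j u / Ω j) * θ u v with hw
  have hw0 : ∀ j u v, 0 ≤ w j u v := fun j u v =>
    mul_nonneg (div_nonneg (hη0 j u) (hΩ0 j)) (hθ u v)
  have hwb : ∀ j u v, w j u v * omegaSel (γ j u v) = w j v u * omegaSel (-γ j u v) := by
    intro j u v
    have h1 := hdb j u v
    rw [hγ j v u] at h1
    have : ∀ x y z : ℝ, x / Ω j * y * z = (x * y * z) / Ω j := fun x y z => by ring
    simp only [hw, this, h1]
  set p : Fin L → V → V → ℝ := fun j u v => w j u v * (if 0 < γ j u v then (1:ℝ) else 0) with hp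
  have hpb := fun j u v => pair_bound (γ j u v) (w j u v) (w j v u) (hw0 j u v) (hw0 j v u) (hwb j u v)
  have hpb1 : ∀ j u v, p j u v + p j v u ≤ (w j u v + w j v u) / 2 := by
    intro j u v
    simp only [hp]; rw [hγ j v u]; exact (hpb j u v).1
  have hpb2 : ∀ j u v, 0 < w j u v → p j u v + p j v u < (w j u v + w j v u) / 2 := by
    intro j u v
    simp only [hp]; rw [hγ j v u]; exact (hpb j u v).2
  have hex : ∃ j u v, 0 < w j u v := by
    by_contra! hcon
    have : T ≤ 0 := by
      rw [hT]
      exact Finset.sum_nonpos fun j _ => Finset.sum_nonpos fun u _ =>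
        Finset.sum_nonpos fun v _ => hcon j u v
    linarith
  obtain ⟨j, u, v, hpos⟩ := hex
  have key : ∑ j, ∑ u, ∑ v, (p j u v + p j v u) < ∑ j, ∑ u, ∑ v, (w j u v + w j v u) / 2 :=
    Finset.sum_lt_sum (fun j _ => Finset.sum_le_sum fun u _ => Finset.sum_le_sum fun v _ => hpb1 j u v)
      ⟨j, Finset.mem_univ _, Finset.sum_lt_sum (fun u _ => Finset.sum_le_sum fun v _ => hpb1 j u v)
        ⟨u, Finset.mem_univ _, Finset.sum_lt_sum (fun v _ => hpb1 j u v)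
          ⟨v, Finset.mem_univ _, hpb2 j u v hpos⟩⟩⟩
  have sw : ∀ f : Fin L → V → V → ℝ,
      ∑ j, ∑ u, ∑ v, (f j u v + f j v u) = 2 * ∑ j, ∑ u, ∑ v, f j u v := by
    intro f
    rw [Finset.mul_sum]
    refine Finset.sum_congr rfl fun j _ => ?_
    simp only [Finset.sum_add_distrib]
    rw [Finset.sum_comm (f := fun u v => f j v u)]
    ring
  rw [sw p] at key
  simp only [← Finset.sum_div] at key
  rw [sw w] at key
  change ∑ j, ∑ u, ∑ v, p j u v < T / 2
  have hT' : T = ∑ j, ∑ u, ∑ v, w j u v := hT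
  linarith
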